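/- Let R be a commutative ring, r ≥ 2, ℓ ≥ 2, and let S = {S^{(a)}_m(u)} be a regular solution in R of the level 2ℓ restricted T-system 𝕋̂_{2ℓ}(A_{2r+1}) with quasi-symmetric condition. Then for all 0 ≤ a ≤ 2r+2, 0 ≤ m ≤ 2ℓ, u ∈ (1/2)ℤ: (1) half-periodicity: S^{(a)}_m(u + r + 1 + ℓ) = (−1)^m S^{(2r+2−a)}_{2ℓ−m}(u) = S^{(a)}_{2ℓ−m}(u); (2) periodicity: S^{(a)}_m(u + 2(r + 1 + ℓ)) = S^{(a)}_m(u). -/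

import Mathlib

open Matrix in
theorem det_two_cols {R : Type*} [CommRing R] (n : ℕ) (A C : Matrix (Fin (n+2)) (Fin (n+2)) R) (d : R)
    (h1 : ∀ i, C i 0 = if i = 0 then d else 0)
    (h2 : ∀ i, C i (Fin.last (n+1)) = if i = Fin.last (n+1) then d else 0)
    (h3 : ∀ i j, j ≠ 0 → j ≠ Fin.last (n+1) → C i j = A i j) :
    C.det = d * (d * (A.submatrix (fun i : Fin n => i.succ.castSucc)
        (fun i : Fin n => i.succ.castSucc)).det) := by
  rw [det_succ_column_zero, Fin.sum_univ_succ, Finset.sum_eq_zero]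
  · rw [det_succ_column _ (Fin.last n), Fin.sum_univ_castSucc, Finset.sum_eq_zero]
    · have hsub : (((C.submatrix (Fin.succAbove 0) Fin.succ).submatrix (Fin.last n).succAbove
          (Fin.last n).succAbove)) = A.submatrix (fun i : Fin n => i.succ.castSucc)
        (fun i : Fin n => i.succ.castSucc) := by
        ext i j
        simp only [submatrix_apply, Fin.succAbove_last, Fin.succAbove_zero]
        rw [h3]
        · rfl
        · exact Fin.succ_ne_zero _
        · simp [Fin.ext_iff]; omega
      rw [hsub]
      simp [h1, h2, ← two_mul]
    · intro i _
      have : i.castSucc.succ ≠ Fin.last (n+1) := by simp [Fin.ext_iff]; omega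
      simp only [submatrix_apply, Fin.succ_last, h2, Fin.succAbove_zero]
      simp [Fin.ext_iff, i.2.ne]
  · intro i _
    simp [h1]

open Matrix in
theorem dodgson_mul {R : Type*} [CommRing R] (n : ℕ) (A : Matrix (Fin (n+2)) (Fin (n+2)) R) :
    A.det * (A.det * (A.submatrix (fun i : Fin n => i.succ.castSucc)
        (fun i : Fin n => i.succ.castSucc)).det)
    = A.det * ((A.submatrix Fin.castSucc Fin.castSucc).det * (A.submatrix Fin.succ Fin.succ).det
      - (A.submatrix Fin.castSucc Fin.succ).det * (A.submatrix Fin.succ Fin.castSucc).det) := by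
  set l : Fin (n+2) := Fin.last (n+1) with hl
  have h0l : (0 : Fin (n+2)) ≠ l := by simp [hl, Fin.ext_iff]
  let U : Matrix (Fin (n+2)) (Fin 2) R := Matrix.of fun i j =>
    if j = 0 then A.adjugate i 0 - (if i = 0 then 1 else 0)
    else A.adjugate i l - (if i = l then 1 else 0)
  let V : Matrix (Fin 2) (Fin (n+2)) R := Matrix.of fun i j =>
    if i = 0 then (if j = 0 then 1 else 0) else (if j = l then 1 else 0)
  have hB : (1 + U * V).det = (A.submatrix Fin.castSucc Fin.castSucc).det *
      (A.submatrix Fin.succ Fin.succ).det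
      - (A.submatrix Fin.castSucc Fin.succ).det * (A.submatrix Fin.succ Fin.castSucc).det := by
    rw [det_one_add_mul_comm, det_fin_two]
    have e00 : A.adjugate 0 0 = (A.submatrix Fin.succ Fin.succ).det := by
      rw [adjugate_fin_succ_eq_det_submatrix]; simp
    have ell : A.adjugate l l = (A.submatrix Fin.castSucc Fin.castSucc).det := by
      rw [adjugate_fin_succ_eq_det_submatrix, hl, Fin.succAbove_last]
      simp [← two_mul]
    have e0l : A.adjugate 0 l = (-1)^(n+1) * (A.submatrix Fin.castSucc Fin.succ).det := by
      rw [adjugate_fin_succ_eq_det_submatrix, hl, Fin.succAbove_last]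
      simp
    have el0 : A.adjugate l 0 = (-1)^(n+1) * (A.submatrix Fin.succ Fin.castSucc).det := by
      rw [adjugate_fin_succ_eq_det_submatrix, hl, Fin.succAbove_last]
      simp
    have hs : ((-1:R)^(n+1))*((-1)^(n+1)) = 1 := by rw [← mul_pow]; simp
    simp [U, V, Matrix.mul_apply, h0l, h0l.symm, e00, ell, e0l, el0]
    linear_combination (-((A.submatrix Fin.castSucc Fin.succ).det * (A.submatrix Fin.succ Fin.castSucc).det)) * hs
  rw [← hB, ← det_mul]
  symm
  have hent : ∀ i j : Fin (n+2), (A * (1 + U * V) : Matrix (Fin (n+2)) (Fin (n+2)) R) i j =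
      if j = 0 then (if i = 0 then A.det else 0) else if j = l then (if i = l then A.det else 0)
      else A i j := by
    intro i j
    have hadj : ∀ j, ∑ k, A i k * A.adjugate k j = if i = j then A.det else 0 := by
      intro j
      have := congrFun (congrFun (mul_adjugate A) i) j
      rw [mul_apply] at this
      rw [this]; simp [Matrix.one_apply]
    have : ∀ k : Fin (n+2), (1 + U * V : Matrix (Fin (n+2)) (Fin (n+2)) R) k j = if j = 0 then A.adjugate k 0 else if j = l then A.adjugate k l
      else (if k = j then 1 else 0) := by
      intro k
      simp only [Matrix.add_apply, Matrix.mul_apply, Fin.sum_univ_two, U, V, Matrix.of_apply,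
        Matrix.one_apply]
      by_cases h1 : j = 0
      · subst h1; simp [h0l]
      · by_cases h2 : j = l
        · subst h2; simp [h0l.symm]
        · simp [h1, h2]
    rw [mul_apply]
    simp_rw [this]
    by_cases h1 : j = 0
    · simp [h1, hadj]
    · by_cases h2 : j = l
      · simp [h2, h0l.symm, hadj]
      · simp [h1, h2]
  apply det_two_cols n A
  · intro i; simp [hent]
  · intro i; rw [hent]; simp [h0l.symm, ← hl]
  · intro i j h1 h2; rw [hent, if_neg h1, if_neg h2]

theorem dodgson {R : Type*} [CommRing R] (n : ℕ) (A : Matrix (Fin (n+2)) (Fin (n+2)) R) :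
    A.det * (A.submatrix (fun i : Fin n => i.succ.castSucc)
        (fun i : Fin n => i.succ.castSucc)).det
    = (A.submatrix Fin.castSucc Fin.castSucc).det * (A.submatrix Fin.succ Fin.succ).det
      - (A.submatrix Fin.castSucc Fin.succ).det * (A.submatrix Fin.succ Fin.castSucc).det := by
  have h := mul_left_cancel₀ (Matrix.det_mvPolynomialX_ne_zero (Fin (n+2)) ℤ)
    (dodgson_mul n (Matrix.mvPolynomialX (Fin (n+2)) (Fin (n+2)) ℤ))
  have h2 := congrArg (MvPolynomial.aeval (fun p : Fin (n+2) × Fin (n+2) => A p.1 p.2)) h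
  have hA := Matrix.mvPolynomialX_mapMatrix_aeval ℤ A
  have hA' : ∀ i j, (MvPolynomial.aeval (fun p : Fin (n+2) × Fin (n+2) => A p.1 p.2))
    (Matrix.mvPolynomialX (Fin (n+2)) (Fin (n+2)) ℤ i j) = A i j := by
    intro i j; exact congrFun (congrFun hA i) j
  have hsub : ∀ (k : ℕ) (f g : Fin k → Fin (n+2)),
      (MvPolynomial.aeval (fun p : Fin (n+2) × Fin (n+2) => A p.1 p.2))
      ((Matrix.mvPolynomialX (Fin (n+2)) (Fin (n+2)) ℤ).submatrix f g).det
      = (A.submatrix f g).det := by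
    intro k f g
    rw [AlgHom.map_det]
    congr 1
    ext i j
    simp
  have hid := hsub (n+2) id id
  simp only [Matrix.submatrix_id_id] at hid
  simpa only [map_mul, map_sub, hsub, hid] using h2

theorem det_alt_odd {R : Type*} [CommRing R] (n : ℕ) (hn : n % 2 = 1) (A : Matrix (Fin n) (Fin n) R)
    (h0 : ∀ i, A i i = 0) (h1 : ∀ i j, A i j = - A j i) : A.det = 0 := by
  let X : Matrix (Fin n) (Fin n) (MvPolynomial (Fin n × Fin n) ℤ) := Matrix.of fun i j =>
    if i < j then MvPolynomial.X (i, j) else if j < i then - MvPolynomial.X (j, i) else 0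
  have hX : X.transpose = - X := by
    ext1 i j
    simp only [Matrix.transpose_apply, Matrix.neg_apply, X, Matrix.of_apply]
    rcases lt_trichotomy i j with h | h | h
    · simp [h, h.not_gt]
    · simp [h]
    · simp [h, h.not_gt]
  have hd : X.det = 0 := by
    have := congrArg Matrix.det hX
    rw [Matrix.det_transpose, Matrix.det_neg, Fintype.card_fin,
      Odd.neg_one_pow (Nat.odd_iff.mpr hn)] at this
    have h2 : (2 : MvPolynomial (Fin n × Fin n) ℤ) * X.det = 0 := by linear_combination this
    exact (mul_eq_zero.mp h2).resolve_left two_ne_zero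
  have := congrArg (MvPolynomial.aeval (fun p : Fin n × Fin n => A p.1 p.2)) hd
  rw [AlgHom.map_det, map_zero] at this
  rw [← this]
  congr 1
  ext i j
  simp only [AlgHom.mapMatrix_apply, Matrix.map_apply, X, Matrix.of_apply]
  rcases lt_trichotomy i j with h | h | h
  · simp [h]
  · simp [h, h0]
  · simp [h, h.not_gt]; exact h1 i j

/-- row combination lemma -/
theorem det_rowcomb {R : Type*} [CommRing R] (n : ℕ) (M : Matrix (Fin (n+1)) (Fin (n+1)) R)
    (c : Fin (n+1) → R) (hc : c 0 = 1)
    (hz : ∀ q : Fin n, ∑ p, c p * M p q.castSucc = 0) :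
    M.det = (-1)^n * (∑ p, c p * M p (Fin.last n)) * (M.submatrix Fin.succ Fin.castSucc).det := by
  have h := Matrix.det_updateRow_sum M 0 c
  rw [hc, one_smul] at h
  rw [← h, Matrix.det_succ_row_zero, Fin.sum_univ_castSucc, Finset.sum_eq_zero]
  · simp only [Matrix.updateRow_self, Finset.sum_apply, Pi.smul_apply, smul_eq_mul, zero_add,
      Fin.val_last, Fin.succAbove_last]
    congr 2
  · intro q _
    simp [Matrix.updateRow_self, Finset.sum_apply, hz]

structure IsSol {R : Type*} [CommRing R] (r ℓ : ℕ) (S : ℕ → ℕ → ℤ → R) : Prop where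
  hr : 2 ≤ r
  hℓ : 2 ≤ ℓ
  hunit : ∀ a m v, a ≤ 2 * r + 2 → m ≤ 2 * ℓ → ¬(a = r + 1 ∧ m % 2 = 1) → IsUnit (S a m v)
  hzero : ∀ m v, m % 2 = 1 → S (r + 1) m v = 0
  hb1 : ∀ a v, a ≤ 2 * r + 2 → S a 0 v = 1
  hb2 : ∀ a v, a ≤ 2 * r + 2 → S a (2 * ℓ) v = 1
  hb3 : ∀ m v, m ≤ 2 * ℓ → S 0 m v = 1
  hb4 : ∀ m v, m ≤ 2 * ℓ → S (2 * r + 2) m v = (-1) ^ m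
  hsym : ∀ a m v, a ≤ 2 * r + 2 → m ≤ 2 * ℓ → S a m v = (-1) ^ m * S (2 * r + 2 - a) m v
  hsys : ∀ a m v, 1 ≤ a → a ≤ 2 * r + 1 → 1 ≤ m → m ≤ 2 * ℓ - 1 →
      S a m (v - 1) * S a m (v + 1)
        = S a (m - 1) v * S a (m + 1) v + S (a - 1) m v * S (a + 1) m v

/-- extended first column of data -/
def ee {R : Type*} [CommRing R] (r : ℕ) (S : ℕ → ℕ → ℤ → R) (c x : ℤ) : R :=
  if 0 ≤ c ∧ c ≤ 2 * r + 2 then S c.toNat 1 x else 0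

def DM {R : Type*} [CommRing R] (r : ℕ) (S : ℕ → ℕ → ℤ → R) (a : ℤ) (m : ℕ) (v : ℤ) :
    Matrix (Fin m) (Fin m) R :=
  Matrix.of fun p q => ee r S (a + (q : ℕ) - (p : ℕ)) (v + (p : ℕ) + (q : ℕ) - (m - 1))

theorem DM_dodgson {R : Type*} [CommRing R] (r : ℕ) (S : ℕ → ℕ → ℤ → R) (a : ℤ) (m : ℕ) (v : ℤ) :
    (DM r S a (m+1) (v-1)).det * (DM r S a (m+1) (v+1)).det =
    (DM r S a m v).det * (DM r S a (m+2) v).det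
      + (DM r S (a-1) (m+1) v).det * (DM r S (a+1) (m+1) v).det := by
  have h := dodgson m (DM r S a (m+2) v)
  have h1 : (DM r S a (m+2) v).submatrix (fun i : Fin m => i.succ.castSucc)
        (fun i : Fin m => i.succ.castSucc) = DM r S a m v := by
    ext p q; simp only [DM, Matrix.submatrix_apply, Matrix.of_apply]; congr 1 <;> simp <;> ring
  have h2 : (DM r S a (m+2) v).submatrix Fin.castSucc Fin.castSucc = DM r S a (m+1) (v-1) := by
    ext p q; simp only [DM, Matrix.submatrix_apply, Matrix.of_apply]; congr 1 <;> simp <;> ring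
  have h3 : (DM r S a (m+2) v).submatrix Fin.succ Fin.succ = DM r S a (m+1) (v+1) := by
    ext p q; simp only [DM, Matrix.submatrix_apply, Matrix.of_apply]; congr 1 <;> simp <;> ring
  have h4 : (DM r S a (m+2) v).submatrix Fin.castSucc Fin.succ = DM r S (a+1) (m+1) v := by
    ext p q; simp only [DM, Matrix.submatrix_apply, Matrix.of_apply]; congr 1 <;> simp <;> ring
  have h5 : (DM r S a (m+2) v).submatrix Fin.succ Fin.castSucc = DM r S (a-1) (m+1) v := by
    ext p q; simp only [DM, Matrix.submatrix_apply, Matrix.of_apply]; congr 1 <;> simp <;> ring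
  rw [h1, h2, h3, h4, h5] at h
  linear_combination -h

namespace IsSol
variable {R : Type*} [CommRing R] {r ℓ : ℕ} {S : ℕ → ℕ → ℤ → R}

theorem ee_sym (H : IsSol r ℓ S) (c x : ℤ) : ee r S c x = - ee r S (2 * r + 2 - c) x := by
  have := H.hℓ
  unfold ee
  by_cases h : 0 ≤ c ∧ c ≤ 2 * r + 2
  · rw [if_pos h, if_pos (by omega), H.hsym _ _ _ (by omega) (by omega)]
    have : (2 * (r:ℤ) + 2 - c).toNat = 2 * r + 2 - c.toNat := by omega
    rw [this]; simp
  · rw [if_neg h, if_neg (by omega)]; simp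

theorem ee_zero (H : IsSol r ℓ S) (x : ℤ) : ee r S 0 x = 1 := by
  have := H.hℓ
  unfold ee
  rw [if_pos (by omega)]
  exact H.hb3 _ _ (by omega)

theorem ee_mid (H : IsSol r ℓ S) (x : ℤ) : ee r S (r+1) x = 0 := by
  unfold ee
  rw [if_pos (by omega)]
  have : ((r:ℤ)+1).toNat = r+1 := by omega
  rw [this]
  exact H.hzero _ _ (by omega)

theorem D_mid (H : IsSol r ℓ S) (m : ℕ) (hm : m % 2 = 1) (v : ℤ) : (DM r S (r+1) m v).det = 0 := by
  apply det_alt_odd m hm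
  · intro i
    simp only [DM, Matrix.of_apply]
    rw [add_sub_cancel_right]; exact H.ee_mid _
  · intro i j
    simp only [DM, Matrix.of_apply]
    rw [H.ee_sym]
    congr 2 <;> ring

theorem D_zero (H : IsSol r ℓ S) (m : ℕ) (v : ℤ) : (DM r S 0 m v).det = 1 := by
  rw [Matrix.det_of_upperTriangular]
  · apply Finset.prod_eq_one
    intro i _
    simp only [DM, Matrix.of_apply]
    rw [add_sub_cancel_right]; exact H.ee_zero _
  · intro i j hij
    simp only [DM, Matrix.of_apply, ee]
    rw [if_neg]
    have : (j:ℕ) < i := hij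
    omega

theorem D_sym (H : IsSol r ℓ S) (a : ℤ) (m : ℕ) (v : ℤ) :
    (DM r S (2 * r + 2 - a) m v).det = (-1)^m * (DM r S a m v).det := by
  have : DM r S (2 * r + 2 - a) m v = - (DM r S a m v).transpose := by
    ext p q
    simp only [DM, Matrix.of_apply, Matrix.neg_apply, Matrix.transpose_apply]
    rw [H.ee_sym]
    congr 2 <;> ring
  rw [this, Matrix.det_neg, Matrix.det_transpose, Fintype.card_fin]

theorem D_eq (H : IsSol r ℓ S) : ∀ (m : ℕ), m ≤ 2 * ℓ → ∀ (a : ℕ), a ≤ 2 * r + 2 → ∀ v : ℤ,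
    (DM r S a m v).det = S a m v := by
  intro m
  induction m using Nat.strong_induction_on with
  | _ m ih =>
  intro hm a ha v
  match m, ih, hm with
  | 0, _, _ => rw [H.hb1 _ _ ha]; simp
  | 1, _, _ =>
    rw [Matrix.det_fin_one]
    simp only [DM, Matrix.of_apply, ee]
    rw [if_pos (by simp; omega)]
    simp
  | m+2, ih, hm =>
    rcases Nat.eq_zero_or_pos a with h0 | h0
    · subst h0
      rw [H.hb3 _ _ hm]; exact H.D_zero _ _
    rcases Nat.lt_or_ge (2 * r + 1) a with h1 | h1
    · have : a = 2 * r + 2 := by omega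
      subst this
      rw [H.hb4 _ _ hm]
      have := H.D_sym 0 (m+2) v
      rw [H.D_zero] at this
      push_cast
      simpa using this
    by_cases h2 : a = r + 1 ∧ m % 2 = 1
    · obtain ⟨rfl, h2⟩ := h2
      rw [H.hzero _ _ (by omega)]
      push_cast
      exact H.D_mid _ (by omega) _
    · have hu := H.hunit a m v ha (by omega) h2
      have e1 := DM_dodgson r S a m v
      have e2 := H.hsys a (m+1) v h0 h1 (by omega) (by omega)
      have c1 : ((a:ℤ) - 1) = ((a-1 : ℕ) : ℤ) := by omega
      have c2 : ((a:ℤ) + 1) = ((a+1 : ℕ) : ℤ) := by omega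
      rw [c1, c2, ih (m+1) (by omega) (by omega) a ha, ih (m+1) (by omega) (by omega) a ha,
        ih m (by omega) (by omega) a ha, ih (m+1) (by omega) (by omega) _ (by omega),
        ih (m+1) (by omega) (by omega) _ (by omega)] at e1
      apply hu.mul_left_cancel
      rw [e1] at e2
      simpa using e2

theorem D_top (H : IsSol r ℓ S) (a : ℕ) (h0 : 1 ≤ a) (h1 : a ≤ 2 * r + 1) (v : ℤ) :
    (DM r S a (2 * ℓ + 1) v).det = 0 := by
  have hℓ := H.hℓ
  by_cases h2 : a = r + 1
  · subst h2
    push_cast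
    exact H.D_mid _ (by omega) _
  · have hu := H.hunit a (2 * ℓ - 1) v (by omega) (by omega) (by tauto)
    have e1 := DM_dodgson r S a (2 * ℓ - 1) v
    have c1 : ((a:ℤ) - 1) = ((a-1 : ℕ) : ℤ) := by omega
    have c2 : ((a:ℤ) + 1) = ((a+1 : ℕ) : ℤ) := by omega
    have c3 : 2 * ℓ - 1 + 1 = 2 * ℓ := by omega
    have c4 : 2 * ℓ - 1 + 2 = 2 * ℓ + 1 := by omega
    rw [c1, c2, c3, c4, H.D_eq _ le_rfl _ (by omega), H.D_eq _ le_rfl _ (by omega),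
      H.D_eq _ le_rfl _ (by omega), H.D_eq _ le_rfl _ (by omega), H.D_eq _ (by omega) _ (by omega),
      H.hb2 _ _ (by omega), H.hb2 _ _ (by omega), H.hb2 _ _ (by omega), H.hb2 _ _ (by omega)] at e1
    apply hu.mul_left_cancel
    linear_combination -e1

/-- the determinant with row combination -/
theorem D_comb (H : IsSol r ℓ S) (a : ℤ) (n : ℕ) (w : ℤ)
    (hz : ∀ q : ℕ, q < n → ∑ p ∈ Finset.range (n+1), (-1)^p * S 1 p (w+p) *
      ee r S (a + q - p) (w + (a + q) + p) = 0) :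
    (DM r S a (n+1) (w + a + n)).det = (-1)^n * (∑ p ∈ Finset.range (n+1), (-1)^p * S 1 p (w+p) *
      ee r S (a + n - p) (w + (a + n) + p)) * (DM r S (a-1) n (w + a + n)).det := by
  have hr := H.hr
  have hent : ∀ p q : Fin (n+1), DM r S a (n+1) (w+a+n) p q
      = ee r S (a + (q:ℕ) - (p:ℕ)) (w + (a + (q:ℕ)) + (p:ℕ)) := by
    intro p q
    simp only [DM, Matrix.of_apply]
    congr 1
    push_cast; ring
  rw [det_rowcomb n _ (fun p => (-1)^(p:ℕ) * S 1 p (w+(p:ℕ)))]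
  · simp only [hent]
    rw [Finset.sum_range]
    congr 2
    ext p q
    simp only [DM, Matrix.of_apply, Matrix.submatrix_apply]
    congr 1 <;> simp <;> ring
  · simp [H.hb1]
  · intro q
    simp only [hent]
    rw [← hz q q.2, Finset.sum_range]
    rfl

theorem rec_low (H : IsSol r ℓ S) (w : ℤ) : ∀ b : ℕ, 1 ≤ b → b ≤ 2 * ℓ →
    ∑ p ∈ Finset.range (b+1), (-1)^p * S 1 p (w+p) * ee r S (b - p) (w + b + p) = 0 := by
  have hr := H.hr
  intro b
  induction b using Nat.strong_induction_on with
  | _ b ih =>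
  intro hb hb'
  obtain ⟨n, rfl⟩ : ∃ n, b = n+1 := ⟨b-1, by omega⟩
  have h := H.D_comb 1 n w ?_
  · have hd := H.D_eq (n+1) hb' 1 (by omega) (w + 1 + n)
    have hd0 : (DM r S (1-1) n (w+1+n)).det = 1 := H.D_zero _ _
    rw [Nat.cast_one] at hd
    rw [hd, hd0, mul_one] at h
    rw [Finset.sum_range_succ]
    have e1 : (((n+1:ℕ):ℤ) - ((n+1:ℕ):ℤ)) = 0 := sub_self _
    rw [e1, H.ee_zero]
    have e2 : w + ((n+1:ℕ):ℤ) = w + 1 + n := by push_cast; ring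
    rw [e2, h]
    have e3 : ((n+1:ℕ):ℤ) = 1 + n := by push_cast; ring
    simp only [e3]
    have e4 : w + 1 + (n:ℤ) = w + (1 + n) := by ring
    simp only [e4]
    have hs : ((-1:R)^(n))*((-1)^(n)) = 1 := by rw [← mul_pow]; simp
    rw [pow_succ]
    linear_combination (-(∑ p ∈ Finset.range (n+1), (-1)^p * S 1 p (w+p) *
      ee r S (1 + n - p) (w + (1 + n) + p))) * hs
  · intro q hq
    have := ih (q+1) (by omega) (by omega) (by omega)
    rw [← Finset.sum_subset (s₁ := Finset.range (q+1+1)), ← this]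
    · apply Finset.sum_congr rfl
      intro p _
      congr 2 <;> push_cast <;> ring
    · intro p; simp; omega
    · intro p _ hp
      simp at hp
      rw [ee, if_neg (by omega), mul_zero]

theorem rec_all (H : IsSol r ℓ S) (w : ℤ) : ∀ b : ℕ, 1 ≤ b → b ≤ 2 * ℓ + 2 * r + 1 →
    ∑ p ∈ Finset.range (2 * ℓ + 1), (-1)^p * S 1 p (w+p) * ee r S (b - p) (w + b + p) = 0 := by
  have hr := H.hr
  intro b
  induction b using Nat.strong_induction_on with
  | _ b ih =>
  intro hb hb'
  by_cases hbl : b ≤ 2 * ℓ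
  · rw [← H.rec_low w b hb hbl]
    symm
    apply Finset.sum_subset
    · intro p; simp; omega
    · intro p _ hp
      simp at hp
      rw [ee, if_neg (by omega), mul_zero]
  · obtain ⟨a, rfl⟩ : ∃ a, b = a + 1 + 2 * ℓ := ⟨b - 1 - 2 * ℓ, by omega⟩
    have h := H.D_comb (a+1) (2 * ℓ) w ?_
    · have h1 := H.D_top (a+1) (by omega) (by omega) (w + (a + 1) + (2 * ℓ : ℕ))
      have h2 := H.D_eq (2 * ℓ) le_rfl a (by omega) (w + (a + 1) + (2 * ℓ : ℕ))
      rw [H.hb2 _ _ (by omega)] at h2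
      rw [Nat.cast_succ] at h1
      rw [add_sub_cancel_right, h1, h2] at h
      simp only [mul_one, even_two, Even.mul_right, Even.neg_pow, one_pow, one_mul] at h
      rw [h]
      simp
    · intro q hq
      rw [← ih (a + 1 + q) (by omega) (by omega) (by omega)]
      simp

theorem neg (H : IsSol r ℓ S) : IsSol r ℓ (fun a m v => S a m (-v)) where
  hr := H.hr
  hℓ := H.hℓ
  hunit a m v := H.hunit a m (-v)
  hzero m v := H.hzero m (-v)
  hb1 a v := H.hb1 a (-v)
  hb2 a v := H.hb2 a (-v)
  hb3 a v := H.hb3 a (-v)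
  hb4 a v := H.hb4 a (-v)
  hsym a m v := H.hsym a m (-v)
  hsys a m v h1 h2 h3 h4 := by
    have := H.hsys a m (-v) h1 h2 h3 h4
    rw [← this, mul_comm]
    congr 2 <;> ring

theorem rec_flip (H : IsSol r ℓ S) (w : ℤ) (b : ℕ) (hb : 1 ≤ b) (hb' : b ≤ 2 * ℓ + 2 * r + 1) :
    ∑ p ∈ Finset.range (2 * ℓ + 1), (-1)^p * S 1 (2 * ℓ - p) (w + p + 2 * (r + 1 + ℓ)) *
      ee r S (b - p) (w + b + p) = 0 := by
  have h := H.neg.rec_all (-(w + 2 * r + 2 + 4 * ℓ)) (2 * ℓ + 2 * r + 2 - b) (by omega) (by omega)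
  rw [← Finset.sum_range_reflect] at h
  rw [← neg_eq_zero, ← Finset.sum_neg_distrib, ← h]
  apply Finset.sum_congr rfl
  intro p hp
  simp only [Finset.mem_range] at hp
  have hp' : 2 * ℓ + 1 - 1 - p = 2 * ℓ - p := by omega
  rw [hp']
  have hsg : (-1 : R)^(2 * ℓ - p) = (-1)^p := by
    have h1 : (-1:R)^(2 * ℓ - p) * (-1)^p = 1 := by
      rw [← pow_add, Nat.sub_add_cancel (by omega)]; simp
    have h2 : (-1:R)^p * (-1)^p = 1 := by rw [← mul_pow]; simp
    linear_combination (-1:R)^p * h1 - (-1:R)^(2 * ℓ - p) * h2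
  have hne : ∀ c x : ℤ, ee r (fun a m v => S a m (-v)) c x = ee r S c (-x) := fun c x => rfl
  rw [hsg, hne, H.ee_sym (b - p), mul_neg, neg_neg]
  have c1 : ((2 * ℓ - p : ℕ) : ℤ) = 2 * ℓ - p := by omega
  have c2 : ((2 * ℓ + 2 * r + 2 - b : ℕ) : ℤ) = 2 * ℓ + 2 * r + 2 - b := by omega
  rw [c1, c2]
  congr 2
  · congr 1; ring
  · ring
  · ring

theorem half_one (H : IsSol r ℓ S) : ∀ m : ℕ, m ≤ 2 * ℓ → ∀ v : ℤ,
    S 1 m v = S 1 (2 * ℓ - m) (v + 2 * (r + 1 + ℓ)) := by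
  have hr := H.hr
  suffices h : ∀ m : ℕ, m ≤ 2 * ℓ → ∀ w : ℤ,
      S 1 m (w + m) = S 1 (2 * ℓ - m) (w + m + 2 * (r + 1 + ℓ)) by
    intro m hm v
    have := h m hm (v - m)
    simpa using this
  intro m
  induction m using Nat.strong_induction_on with
  | _ m ih =>
  intro hm w
  rcases Nat.eq_zero_or_pos m with h0 | h0
  · subst h0
    rw [Nat.sub_zero, H.hb1 _ _ (by omega), H.hb2 _ _ (by omega)]
  have e1 := H.rec_all w m h0 (by omega)
  have e2 := H.rec_flip w m h0 (by omega)
  have key : ∀ f : ℕ → R, ∑ p ∈ Finset.range (2 * ℓ + 1), (-1)^p * f p *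
      ee r S (m - p) (w + m + p) = ∑ p ∈ Finset.range m, (-1)^p * f p *
      ee r S (m - p) (w + m + p) + (-1)^m * f m := by
    intro f
    rw [← Finset.sum_subset (s₁ := Finset.range (m+1)), Finset.sum_range_succ, sub_self,
      H.ee_zero, mul_one]
    · intro p; simp; omega
    · intro p _ hp
      simp at hp
      rw [ee, if_neg (by omega), mul_zero]
  rw [key (fun p => S 1 p (w + p))] at e1
  rw [key (fun p => S 1 (2 * ℓ - p) (w + p + 2 * (r + 1 + ℓ)))] at e2
  have e3 : ∑ p ∈ Finset.range m, (-1)^p * S 1 p (w + p) * ee r S (m - p) (w + m + p)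
     = ∑ p ∈ Finset.range m, (-1)^p * S 1 (2 * ℓ - p) (w + p + 2 * (r + 1 + ℓ)) *
      ee r S (m - p) (w + m + p) := by
    apply Finset.sum_congr rfl
    intro p hp
    simp only [Finset.mem_range] at hp
    rw [ih p hp (by omega)]
  rw [e3] at e1
  have h2 : (-1:R)^m * (-1)^m = 1 := by rw [← mul_pow]; simp
  have e4 := e1.trans e2.symm
  have e5 := add_left_cancel e4
  have e6 := congrArg (fun x => (-1:R)^m * x) e5
  simpa only [← mul_assoc, h2, one_mul] using e6

theorem half_low (H : IsSol r ℓ S) : ∀ a : ℕ, a ≤ r + 1 → ∀ m : ℕ, m ≤ 2 * ℓ → ∀ v : ℤ,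
    S a m (v + 2 * (r + 1 + ℓ)) = S a (2 * ℓ - m) v := by
  intro a
  induction a using Nat.strong_induction_on with
  | _ a ih =>
  intro ha m hm v
  match a, ih, ha with
  | 0, _, _ => rw [H.hb3 _ _ hm, H.hb3 _ _ (by omega)]
  | 1, _, _ =>
    rw [H.half_one (2 * ℓ - m) (by omega) v]
    congr 1; omega
  | a+2, ih, ha =>
    rcases Nat.eq_zero_or_pos m with h0 | h0
    · subst h0
      rw [Nat.sub_zero, H.hb1 _ _ (by omega), H.hb2 _ _ (by omega)]
    rcases Nat.eq_or_lt_of_le hm with h1 | h1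
    · subst h1
      rw [Nat.sub_self, H.hb1 _ _ (by omega), H.hb2 _ _ (by omega)]
    have e1 := H.hsys (a+1) m (v + 2 * (r + 1 + ℓ)) (by omega) (by omega) h0 (by omega)
    have e2 := H.hsys (a+1) (2 * ℓ - m) v (by omega) (by omega) (by omega) (by omega)
    have c1 : v + 2 * ((r:ℤ) + 1 + ℓ) - 1 = (v - 1) + 2 * (r + 1 + ℓ) := by ring
    have c2 : v + 2 * ((r:ℤ) + 1 + ℓ) + 1 = (v + 1) + 2 * (r + 1 + ℓ) := by ring
    have c3 : a + 1 - 1 = a := by omega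
    have c4 : 2 * ℓ - (m - 1) = 2 * ℓ - m + 1 := by omega
    have c5 : 2 * ℓ - (m + 1) = 2 * ℓ - m - 1 := by omega
    rw [c1, c2, c3, ih (a+1) (by omega) (by omega) m hm, ih (a+1) (by omega) (by omega) m hm,
      ih (a+1) (by omega) (by omega) (m-1) (by omega),
      ih (a+1) (by omega) (by omega) (m+1) (by omega),
      ih a (by omega) (by omega) m hm, c4, c5] at e1
    rw [c3] at e2
    have hu := H.hunit a (2 * ℓ - m) v (by omega) (by omega) (by omega)
    apply hu.mul_left_cancel
    linear_combination e2 - e1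

theorem sgn (ℓ m : ℕ) (hm : m ≤ 2 * ℓ) : (-1 : R)^(2 * ℓ - m) = (-1)^m := by
  have h1 : (-1:R)^(2 * ℓ - m) * (-1)^m = 1 := by
    rw [← pow_add, Nat.sub_add_cancel (by omega)]; simp
  have h2 : (-1:R)^m * (-1)^m = 1 := by rw [← mul_pow]; simp
  linear_combination (-1:R)^m * h1 - (-1:R)^(2 * ℓ - m) * h2

theorem half (H : IsSol r ℓ S) (a m : ℕ) (v : ℤ) (ha : a ≤ 2 * r + 2) (hm : m ≤ 2 * ℓ) :
    S a m (v + 2 * (r + 1 + ℓ)) = S a (2 * ℓ - m) v := by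
  by_cases h : a ≤ r + 1
  · exact H.half_low a h m hm v
  · rw [H.hsym a m _ ha hm, H.hsym a (2 * ℓ - m) _ ha (by omega),
      H.half_low _ (by omega) m hm v, sgn ℓ m hm]

end IsSol


/-- Periodicity of the level `2ℓ` restricted T-system `𝕋̂_{2ℓ}(A_{2r+1})` with the
quasi-symmetric condition.  The half-integer spectral parameter `u ∈ (1/2)ℤ` is
encoded by the integer `v = 2u`; a shift of `u` by `1/2` (resp. `r+1+ℓ`) corresponds
to a shift of `v` by `1` (resp. `2(r+1+ℓ)`). -/
theorem restricted_That_A_periodicity {R : Type*} [CommRing R]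
    (r ℓ : ℕ) (hr : 2 ≤ r) (hℓ : 2 ≤ ℓ)
    (S : ℕ → ℕ → ℤ → R)
    (hunit : ∀ a m v, a ≤ 2 * r + 2 → m ≤ 2 * ℓ → ¬(a = r + 1 ∧ m % 2 = 1) →
      IsUnit (S a m v))
    (hzero : ∀ m v, m % 2 = 1 → S (r + 1) m v = 0)
    (hb1 : ∀ a v, a ≤ 2 * r + 2 → S a 0 v = 1)
    (hb2 : ∀ a v, a ≤ 2 * r + 2 → S a (2 * ℓ) v = 1)
    (hb3 : ∀ m v, m ≤ 2 * ℓ → S 0 m v = 1)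
    (hb4 : ∀ m v, m ≤ 2 * ℓ → S (2 * r + 2) m v = (-1) ^ m)
    (hsym : ∀ a m v, a ≤ 2 * r + 2 → m ≤ 2 * ℓ →
      S a m v = (-1) ^ m * S (2 * r + 2 - a) m v)
    (hsys : ∀ a m v, 1 ≤ a → a ≤ 2 * r + 1 → 1 ≤ m → m ≤ 2 * ℓ - 1 →
      S a m (v - 1) * S a m (v + 1)
        = S a (m - 1) v * S a (m + 1) v + S (a - 1) m v * S (a + 1) m v) :
    (∀ a m v, a ≤ 2 * r + 2 → m ≤ 2 * ℓ →
      S a m (v + 2 * ((r : ℤ) + 1 + ℓ)) = (-1) ^ m * S (2 * r + 2 - a) (2 * ℓ - m) v) ∧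
    (∀ a m v, a ≤ 2 * r + 2 → m ≤ 2 * ℓ →
      S a m (v + 2 * ((r : ℤ) + 1 + ℓ)) = S a (2 * ℓ - m) v) ∧
    (∀ a m v, a ≤ 2 * r + 2 → m ≤ 2 * ℓ →
      S a m (v + 4 * ((r : ℤ) + 1 + ℓ)) = S a m v) := by
  have H : IsSol r ℓ S := ⟨hr, hℓ, hunit, hzero, hb1, hb2, hb3, hb4, hsym, hsys⟩
  refine ⟨fun a m v ha hm => ?_, fun a m v ha hm => H.half a m v ha hm, fun a m v ha hm => ?_⟩
  · rw [H.half a m v ha hm, hsym a (2 * ℓ - m) v ha (by omega), IsSol.sgn ℓ m hm]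
  · have e : v + 4 * ((r : ℤ) + 1 + ℓ) = (v + 2 * (r + 1 + ℓ)) + 2 * (r + 1 + ℓ) := by ring
    rw [e, H.half a m _ ha hm, H.half a (2 * ℓ - m) v ha (by omega)]
    congr 1; omega
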